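/- arXiv:2405.07139 — 3 statements merged into one kernel-verified Lean document; each statement's English description precedes it below -/
import Mathlib

section
/- Let n ≥ 1, let A₁, A₂ ∈ ℝ^{n×n}, let θ₁, θ₂ : P → ℝ be functions on a parameter set P, and set A(μ) = θ₁(μ)A₁ + θ₂(μ)A₂. Suppose A(μ₀) is invertible and B = A(μ₀)⁻¹. If for each i ∈ {1,2} the vectors (θ₁(μᵢ), θ₂(μᵢ)) and (θ₁(μ₀), θ₂(μ₀)) in ℝ² are linearly independent, then for every integer m ≥ 1 and every v ∈ ℝⁿ one has K_m(BA(μ₁), v) = K_m(BA(μ₂), v) and K_m(Bᵀ A(μ₁)ᵀ, v) = K_m(Bᵀ A(μ₂)ᵀ, v). -/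
open Matrix

/-- Krylov subspace `K_m(C, v) = span {v, Cv, ..., C^{m-1} v}`. -/
noncomputable def krylov {n : ℕ} (C : Matrix (Fin n) (Fin n) ℝ) (v : Fin n → ℝ) (m : ℕ) :
    Submodule ℝ (Fin n → ℝ) :=
  Submodule.span ℝ {w | ∃ k < m, w = (C ^ k) *ᵥ v}

theorem krylov_mono {n : ℕ} (C : Matrix (Fin n) (Fin n) ℝ) (v : Fin n → ℝ) :
    Monotone (krylov C v) := by
  intro m m' h
  apply Submodule.span_mono
  rintro w ⟨k, hk, rfl⟩
  exact ⟨k, hk.trans_le h, rfl⟩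

theorem mulVec_mem_krylov_succ {n : ℕ} (C : Matrix (Fin n) (Fin n) ℝ) {v w : Fin n → ℝ} {m : ℕ}
    (hw : w ∈ krylov C v m) : C *ᵥ w ∈ krylov C v (m + 1) := by
  suffices h : krylov C v m ≤ (krylov C v (m + 1)).comap C.mulVecLin from h hw
  refine Submodule.span_le.mpr ?_
  rintro w ⟨k, hk, rfl⟩
  refine Submodule.subset_span ⟨k + 1, by omega, ?_⟩
  simp [pow_succ', Matrix.mulVec_mulVec]

theorem krylov_smul_add_smul_one_le {n : ℕ} (C : Matrix (Fin n) (Fin n) ℝ) (a b : ℝ)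
    (v : Fin n → ℝ) (m : ℕ) :
    krylov (a • C + b • (1 : Matrix (Fin n) (Fin n) ℝ)) v m ≤ krylov C v m := by
  have key (k : ℕ) : ((a • C + b • (1 : Matrix (Fin n) (Fin n) ℝ)) ^ k) *ᵥ v ∈
      krylov C v (k + 1) := by
    induction k with
    | zero => exact Submodule.subset_span ⟨0, by omega, by simp⟩
    | succ k ih =>
      rw [pow_succ', ← Matrix.mulVec_mulVec, Matrix.add_mulVec, Matrix.smul_mulVec,
        Matrix.smul_mulVec, Matrix.one_mulVec]
      exact add_mem (Submodule.smul_mem _ _ (mulVec_mem_krylov_succ C ih))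
        (Submodule.smul_mem _ _ (krylov_mono C v (Nat.le_succ _) ih))
  refine Submodule.span_le.mpr ?_
  rintro w ⟨k, hk, rfl⟩
  exact krylov_mono C v hk (key k)

theorem exists_eq_combination_of_linearIndependent_pair {x₁ y₁ x₀ y₀ : ℝ}
    (h : LinearIndependent ℝ ![(x₁, y₁), (x₀, y₀)]) (x y : ℝ) :
    ∃ a b : ℝ, x = a * x₁ + b * x₀ ∧ y = a * y₁ + b * y₀ := by
  rw [LinearIndependent.pair_iff] at h
  have hd : x₁ * y₀ - x₀ * y₁ ≠ 0 := by
    intro hd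
    have hy := h y₀ (-y₁) (by ext <;> simp <;> linarith)
    have hx := h x₀ (-x₁) (by ext <;> simp <;> linarith)
    have h1 := h 1 0 (by ext <;> simp <;> linarith [hx.2, hy.2])
    exact one_ne_zero h1.1
  refine ⟨(x * y₀ - x₀ * y) / (x₁ * y₀ - x₀ * y₁), (x₁ * y - x * y₁) / (x₁ * y₀ - x₀ * y₁), ?_, ?_⟩
  · rw [div_mul_eq_mul_div, div_mul_eq_mul_div, ← add_div, eq_div_iff hd]
    ring
  · rw [div_mul_eq_mul_div, div_mul_eq_mul_div, ← add_div, eq_div_iff hd]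
    ring

theorem stmt0 {n : ℕ} (hn : 1 ≤ n) {P : Type*}
    (A₁ A₂ : Matrix (Fin n) (Fin n) ℝ) (θ₁ θ₂ : P → ℝ)
    (A : P → Matrix (Fin n) (Fin n) ℝ)
    (hA : ∀ μ, A μ = θ₁ μ • A₁ + θ₂ μ • A₂)
    (μ₀ μ₁ μ₂ : P) (h0 : IsUnit (A μ₀))
    (B : Matrix (Fin n) (Fin n) ℝ) (hB : B = (A μ₀)⁻¹)
    (hind₁ : LinearIndependent ℝ ![(θ₁ μ₁, θ₂ μ₁), (θ₁ μ₀, θ₂ μ₀)])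
    (hind₂ : LinearIndependent ℝ ![(θ₁ μ₂, θ₂ μ₂), (θ₁ μ₀, θ₂ μ₀)]) :
    ∀ m : ℕ, 1 ≤ m → ∀ v : Fin n → ℝ,
      krylov (B * A μ₁) v m = krylov (B * A μ₂) v m ∧
      krylov (Bᵀ * (A μ₁)ᵀ) v m = krylov (Bᵀ * (A μ₂)ᵀ) v m := by
  subst hB
  have hdet : IsUnit (A μ₀).det := (Matrix.isUnit_iff_isUnit_det _).mp h0
  have hT : (A μ₀)⁻¹ᵀ * (A μ₀)ᵀ = 1 := by
    rw [← Matrix.transpose_mul, Matrix.mul_nonsing_inv _ hdet, Matrix.transpose_one]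
  have key (μ ν : P) (h : LinearIndependent ℝ ![(θ₁ μ, θ₂ μ), (θ₁ μ₀, θ₂ μ₀)])
      (v : Fin n → ℝ) (m : ℕ) :
      krylov ((A μ₀)⁻¹ * A ν) v m ≤ krylov ((A μ₀)⁻¹ * A μ) v m ∧
      krylov ((A μ₀)⁻¹ᵀ * (A ν)ᵀ) v m ≤ krylov ((A μ₀)⁻¹ᵀ * (A μ)ᵀ) v m := by
    obtain ⟨a, b, h₁, h₂⟩ :=
      exists_eq_combination_of_linearIndependent_pair h (θ₁ ν) (θ₂ ν)
    have hν : A ν = a • A μ + b • A μ₀ := by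
      rw [hA ν, hA μ, hA μ₀, h₁, h₂]
      module
    constructor
    · rw [hν, Matrix.mul_add, Matrix.mul_smul, Matrix.mul_smul, Matrix.nonsing_inv_mul _ hdet]
      exact krylov_smul_add_smul_one_le _ a b v m
    · rw [hν, Matrix.transpose_add, Matrix.transpose_smul, Matrix.transpose_smul,
        Matrix.mul_add, Matrix.mul_smul, Matrix.mul_smul, hT]
      exact krylov_smul_add_smul_one_le _ a b v m
  intro m _ v
  exact ⟨le_antisymm (key μ₂ μ₁ hind₂ v m).1 (key μ₁ μ₂ hind₁ v m).1,
    le_antisymm (key μ₂ μ₁ hind₂ v m).2 (key μ₁ μ₂ hind₁ v m).2⟩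
end

section
/- Let A₁, A₂ ∈ ℝ^{n×n} be symmetric, let θ₁, θ₂ : P → ℝ, and set A(μ) = θ₁(μ)A₁ + θ₂(μ)A₂. Fix μ₀, μ₁, μ ∈ P such that A(μ₀), A(μ₁), and A(μ) are symmetric positive definite, and assume θ₁(μ₀)θ₂(μ₁) − θ₂(μ₀)θ₁(μ₁) ≠ 0 and θ₁(μ₀)θ₂(μ) − θ₂(μ₀)θ₁(μ) ≠ 0. Let B = A(μ₀)⁻¹, f ∈ ℝⁿ, u_μ = A(μ)⁻¹f, and let K_m = K_m(BA(μ₁), Bf) for an integer m ≥ 1. Let û_μ ∈ K_m be the Galerkin solution, i.e., (A(μ)û_μ)ᵀv = fᵀv for all v ∈ K_m. Let κ(μ) = λ_max(BA(μ))/λ_min(BA(μ)) (all eigenvalues of BA(μ) are real and positive since BA(μ) is similar to a symmetric positive definite matrix). Then ‖u_μ − û_μ‖_{A(μ)} ≤ 2·((√κ(μ) − 1)/(√κ(μ) + 1))^m · ‖u_μ‖_{A(μ)}. -/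
open Matrix

/-- The `A`-norm `‖v‖_A = √(vᵀ A v)`. -/
noncomputable def mnorm {n : ℕ} (A : Matrix (Fin n) (Fin n) ℝ) (v : Fin n → ℝ) : ℝ :=
  Real.sqrt (v ⬝ᵥ A *ᵥ v)

open Polynomial RealInnerProductSpace

/-- A symmetric operator's polynomial is bounded by the maximum of the polynomial over the
spectrum. -/
theorem LinearMap.IsSymmetric.norm_aeval_apply_le {E : Type*} [NormedAddCommGroup E]
    [InnerProductSpace ℝ E] [FiniteDimensional ℝ E] {T : Module.End ℝ E}
    (hT : LinearMap.IsSymmetric T) (p : ℝ[X]) {c : ℝ} (hc : 0 ≤ c)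
    (hp : ∀ t, Module.End.HasEigenvalue T t → |p.eval t| ≤ c) (x : E) :
    ‖aeval T p x‖ ≤ c * ‖x‖ := by
  set b := hT.eigenvectorBasis rfl
  have key : ∀ i y, ⟪b i, aeval T p y⟫ = p.eval (hT.eigenvalues rfl i) * ⟪b i, y⟫ := by
    intro i
    clear hp
    induction p using Polynomial.induction_on' with
    | add p q hp hq => intro y; simp [inner_add_right, hp, hq, add_mul]
    | monomial k a =>
      intro y
      have hpow : ⟪b i, (T ^ k) y⟫ = hT.eigenvalues rfl i ^ k * ⟪b i, y⟫ := by
        induction k with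
        | zero => simp
        | succ k ih =>
          rw [pow_succ', Module.End.mul_apply, ← hT, hT.apply_eigenvectorBasis, inner_smul_left,
            ih]
          simp [pow_succ', mul_assoc]
      simp [aeval_monomial, inner_smul_right, hpow, mul_assoc]
  refine abs_le_of_sq_le_sq' ?_ (by positivity) |>.2
  rw [mul_pow, ← b.sum_sq_norm_inner_right, ← b.sum_sq_norm_inner_right, Finset.mul_sum]
  refine Finset.sum_le_sum fun i _ => ?_
  rw [key, norm_mul, mul_pow]
  have := hp _ (hT.hasEigenvalue_eigenvalues rfl i)
  gcongr
  exact this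

/-- A positive definite matrix's inner product is isometric to the Euclidean one. -/
theorem Matrix.PosDef.exists_linearEquiv_inner {n : ℕ} {A : Matrix (Fin n) (Fin n) ℝ}
    (hA : A.PosDef) : ∃ φ : (Fin n → ℝ) ≃ₗ[ℝ] EuclideanSpace ℝ (Fin n),
      ∀ v w, ⟪φ v, φ w⟫ = v ⬝ᵥ A *ᵥ w := by
  open scoped MatrixOrder Matrix.Norms.L2Operator in
  obtain ⟨L, hL, rfl⟩ := CStarAlgebra.isStrictlyPositive_iff_eq_star_mul_self.mp
    hA.isStrictlyPositive
  refine ⟨(L.toLinearEquiv (Pi.basisFun ℝ (Fin n))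
    ((isUnit_iff_isUnit_det L).mp hL)).trans (WithLp.linearEquiv 2 ℝ (Fin n → ℝ)).symm,
    fun v w => ?_⟩
  simp only [LinearEquiv.trans_apply, WithLp.coe_symm_linearEquiv,
    EuclideanSpace.inner_eq_star_dotProduct]
  simp [star_eq_conjTranspose, ← mulVec_mulVec, dotProduct_mulVec,
    vecMul_transpose, conjTranspose_eq_transpose_of_trivial, toLin_eq_toLin',
    dotProduct_comm, toLinearEquiv]

theorem mnorm_aeval_mulVec_le {n : ℕ} {A M : Matrix (Fin n) (Fin n) ℝ} (hA : A.PosDef)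
    (hAM : (A * M).IsSymm) (p : ℝ[X]) {c : ℝ} (hc : 0 ≤ c)
    (hp : ∀ (t : ℝ) (v : Fin n → ℝ), v ≠ 0 → M *ᵥ v = t • v → |p.eval t| ≤ c)
    (x : Fin n → ℝ) : mnorm A (aeval M p *ᵥ x) ≤ c * mnorm A x := by
  obtain ⟨φ, hφ⟩ := hA.exists_linearEquiv_inner
  have hnorm : ∀ v, mnorm A v = ‖φ v‖ := fun v => by
    rw [mnorm, ← hφ, norm_eq_sqrt_real_inner]
  have hA' : A.IsSymm := by
    simpa [IsSymm] using hA.isHermitian.eq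
  set T : Module.End ℝ (EuclideanSpace ℝ (Fin n)) :=
    φ.conjAlgEquiv ℝ (toLinAlgEquiv' M) with hTdef
  have hT : ∀ v, T (φ v) = φ (M *ᵥ v) := fun v => by simp [hTdef]
  have hsymm : LinearMap.IsSymmetric T := by
    intro v w
    obtain ⟨v, rfl⟩ := φ.surjective v
    obtain ⟨w, rfl⟩ := φ.surjective w
    rw [hT, hT, hφ, hφ, mulVec_mulVec, ← hAM.eq, transpose_mul, hA'.eq,
      ← mulVec_mulVec, dotProduct_mulVec v, vecMul_transpose]
  have haev : aeval T p (φ x) = φ (aeval M p *ᵥ x) := by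
    rw [hTdef, Polynomial.aeval_algHom_apply, Polynomial.aeval_algHom_apply]
    simp
  rw [hnorm, hnorm, ← haev]
  refine hsymm.norm_aeval_apply_le p hc (fun t ht => ?_) _
  obtain ⟨v, hv⟩ := ht.exists_hasEigenvector
  obtain ⟨v, rfl⟩ := φ.surjective v
  refine hp t v (fun h => hv.2 (by simp [h])) (φ.injective ?_)
  rw [← hT, hv.apply_eq_smul, map_smul]

/-- Galerkin optimality. -/
theorem mnorm_sub_le_of_galerkin {n : ℕ} {A : Matrix (Fin n) (Fin n) ℝ} (hA : A.PosDef)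
    {K : Submodule ℝ (Fin n → ℝ)} {u y w : Fin n → ℝ} (hy : y ∈ K) (hw : w ∈ K)
    (hgal : ∀ v ∈ K, (A *ᵥ y) ⬝ᵥ v = (A *ᵥ u) ⬝ᵥ v) :
    mnorm A (u - y) ≤ mnorm A (u - w) := by
  obtain ⟨φ, hφ⟩ := hA.exists_linearEquiv_inner
  have horth : ⟪φ (y - w), φ (u - y)⟫ = 0 := by
    rw [hφ, mulVec_sub, dotProduct_sub, dotProduct_comm, dotProduct_comm _ (A *ᵥ y),
      hgal _ (K.sub_mem hy hw), sub_self]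
  have hle : ‖φ (u - y)‖ ≤ ‖φ (u - w)‖ := by
    have h : φ (u - w) = φ (y - w) + φ (u - y) := by rw [← map_add]; congr 1; abel
    have := norm_add_sq_eq_norm_sq_add_norm_sq_real horth
    rw [h]
    nlinarith [norm_nonneg (φ (u - y)), norm_nonneg (φ (y - w) + φ (u - y)),
      mul_self_nonneg ‖φ (y - w)‖]
  simpa only [mnorm, ← hφ, ← norm_eq_sqrt_real_inner] using hle

theorem aeval_mulVec_mem_krylov {n : ℕ} (C : Matrix (Fin n) (Fin n) ℝ) (v : Fin n → ℝ) {m : ℕ}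
    {q : ℝ[X]} (hq : q.natDegree < m) : aeval C q *ᵥ v ∈ krylov C v m := by
  rw [aeval_eq_sum_range, sum_mulVec]
  refine Submodule.sum_mem _ fun k hk => ?_
  rw [smul_mulVec]
  exact Submodule.smul_mem _ _ (Submodule.subset_span
    ⟨k, (Nat.lt_succ_iff.mp (Finset.mem_range.mp hk)).trans_lt hq, rfl⟩)

theorem aeval_affine_mulVec_mem_krylov {n : ℕ} (C : Matrix (Fin n) (Fin n) ℝ) (v : Fin n → ℝ)
    (α β : ℝ) {m : ℕ} {q : ℝ[X]} (hq : q.natDegree < m) :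
    aeval (α • (1 : Matrix (Fin n) (Fin n) ℝ) + β • C) q *ᵥ v ∈ krylov C v m := by
  have h : α • (1 : Matrix (Fin n) (Fin n) ℝ) + β • C =
      aeval C (Polynomial.C α + Polynomial.C β * X) := by
    simp [Algebra.algebraMap_eq_smul_one]
  rw [h, ← aeval_comp]
  refine aeval_mulVec_mem_krylov C v (lt_of_le_of_lt ?_ hq)
  refine natDegree_comp_le.trans ?_
  have : (Polynomial.C α + Polynomial.C β * X : ℝ[X]).natDegree ≤ 1 := by compute_degree
  nlinarith

/-- The scaled Chebyshev polynomial bound. -/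
theorem exists_polynomial_abs_eval_le {a b : ℝ} (ha : 0 < a) (hab : a ≤ b) {m : ℕ} (hm : 1 ≤ m) :
    ∃ p : ℝ[X], p.natDegree ≤ m ∧ p.eval 0 = 1 ∧ ∀ t ∈ Set.Icc a b,
      |p.eval t| ≤ 2 * ((√(b / a) - 1) / (√(b / a) + 1)) ^ m := by
  rcases hab.eq_or_lt with rfl | hlt
  · refine ⟨(1 - C a⁻¹ * X) ^ m, ?_, by simp, fun t ht => ?_⟩
    · refine natDegree_pow_le.trans ?_
      have : (1 - C a⁻¹ * X : ℝ[X]).natDegree ≤ 1 := by compute_degree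
      nlinarith
    · obtain rfl : t = a := le_antisymm ht.2 ht.1
      simp [ha.ne', (by lia : m ≠ 0)]
  set s := √(b / a)
  have hs2 : s ^ 2 = b / a := Real.sq_sqrt (div_nonneg (by linarith) ha.le)
  have hs : 1 < s := Real.lt_sqrt_of_sq_lt (by rw [one_pow, lt_div_iff₀ ha]; linarith)
  have hb : b = s ^ 2 * a := by rw [hs2]; field_simp
  have hs1 : 0 < s - 1 := by linarith
  have hz : 0 < (s + 1) / (s - 1) := div_pos (by linarith) hs1
  have hba : 0 < b - a := by linarith
  have hcosh : (b + a) / (b - a) = Real.cosh (Real.log ((s + 1) / (s - 1))) := by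
    have : s ^ 2 - 1 ≠ 0 := by nlinarith
    have h3 : s ^ 2 * a - a ≠ 0 := by rw [← hb]; exact hba.ne'
    rw [Real.cosh_log hz, hb]
    field_simp
    ring
  set τ := (Chebyshev.T ℝ m).eval ((b + a) / (b - a)) with hτ
  have hτge : ((s + 1) / (s - 1)) ^ m / 2 ≤ τ := by
    rw [hτ, hcosh, Chebyshev.T_real_cosh, Real.cosh_eq, Int.cast_natCast, Real.exp_nat_mul,
      Real.exp_log hz]
    have := Real.exp_pos (-(m * Real.log ((s + 1) / (s - 1))))
    linarith
  have hzm : 0 < ((s + 1) / (s - 1)) ^ m / 2 := by positivity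
  have hτpos : 0 < τ := hzm.trans_le hτge
  refine ⟨C τ⁻¹ * (Chebyshev.T ℝ m).comp (C ((b + a) / (b - a)) - C (2 / (b - a)) * X),
    ?_, ?_, fun t ht => ?_⟩
  · refine (natDegree_C_mul_le _ _).trans (natDegree_comp_le.trans ?_)
    have : (C ((b + a) / (b - a)) - C (2 / (b - a)) * X : ℝ[X]).natDegree ≤ 1 := by
      compute_degree
    rw [Chebyshev.natDegree_T, Int.natAbs_natCast]
    nlinarith
  · simp [← hτ, hτpos.ne']
  · have hT : |(Chebyshev.T ℝ m).eval ((b + a) / (b - a) - 2 / (b - a) * t)| ≤ 1 := by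
      refine Chebyshev.abs_eval_T_real_le_one _ ?_
      rw [show (b + a) / (b - a) - 2 / (b - a) * t = (b + a - 2 * t) / (b - a) by ring, abs_le,
        le_div_iff₀ hba, div_le_iff₀ hba]
      constructor <;> linarith [ht.1, ht.2]
    have hinv : τ⁻¹ ≤ 2 * ((s - 1) / (s + 1)) ^ m := by
      refine (inv_anti₀ hzm hτge).trans_eq ?_
      rw [inv_div, div_eq_mul_inv, ← inv_pow, inv_div]
    simp only [eval_mul, eval_C, eval_comp, eval_sub, eval_X, abs_mul,
      abs_of_pos (inv_pos.mpr hτpos)]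
    exact (mul_le_of_le_one_right (inv_pos.mpr hτpos).le hT).trans hinv

/-- The Galerkin error bound from spectral bounds. -/
theorem galerkin_krylov_error_le {n : ℕ} {A M C : Matrix (Fin n) (Fin n) ℝ} (hA : A.PosDef)
    (hAM : (A * M).IsSymm) {α β : ℝ} (hM : M = α • (1 : Matrix (Fin n) (Fin n) ℝ) + β • C)
    {a b : ℝ} (ha : 0 < a) (hab : a ≤ b)
    (hspec : ∀ (t : ℝ) (v : Fin n → ℝ), v ≠ 0 → M *ᵥ v = t • v → t ∈ Set.Icc a b)
    {m : ℕ} (hm : 1 ≤ m) {u y : Fin n → ℝ} (hy : y ∈ krylov C (M *ᵥ u) m)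
    (hgal : ∀ v ∈ krylov C (M *ᵥ u) m, (A *ᵥ y) ⬝ᵥ v = (A *ᵥ u) ⬝ᵥ v) :
    mnorm A (u - y) ≤ 2 * ((√(b / a) - 1) / (√(b / a) + 1)) ^ m * mnorm A u := by
  obtain ⟨p, hdeg, hp0, hp⟩ := exists_polynomial_abs_eval_le ha hab hm
  have hw : aeval M (-p.divX) *ᵥ (M *ᵥ u) ∈ krylov C (M *ᵥ u) m := by
    rw [hM]
    refine aeval_affine_mulVec_mem_krylov C _ α β ?_
    rw [natDegree_neg, natDegree_divX_eq_natDegree_tsub_one]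
    lia
  have hres : u - aeval M (-p.divX) *ᵥ (M *ᵥ u) = aeval M p *ᵥ u := by
    conv_rhs => rw [← divX_mul_X_add p, coeff_zero_eq_eval_zero, hp0]
    simp [add_mulVec, neg_mulVec, mulVec_mulVec, add_comm]
  refine (mnorm_sub_le_of_galerkin hA hy hw hgal).trans ?_
  rw [hres]
  exact mnorm_aeval_mulVec_le hA hAM p ((abs_nonneg _).trans (hp a ⟨le_rfl, hab⟩))
    (fun t v hv h => hp t (hspec t v hv h)) u


theorem stmt3 {n : ℕ} {P : Type*}
    (A₁ A₂ : Matrix (Fin n) (Fin n) ℝ) (hA₁ : A₁.IsSymm) (hA₂ : A₂.IsSymm)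
    (θ₁ θ₂ : P → ℝ) (A : P → Matrix (Fin n) (Fin n) ℝ)
    (hA : ∀ μ', A μ' = θ₁ μ' • A₁ + θ₂ μ' • A₂)
    (μ₀ μ₁ μ : P)
    (h0 : (A μ₀).PosDef) (h1 : (A μ₁).PosDef) (hμ : (A μ).PosDef)
    (hdet1 : θ₁ μ₀ * θ₂ μ₁ - θ₂ μ₀ * θ₁ μ₁ ≠ 0)
    (hdet2 : θ₁ μ₀ * θ₂ μ - θ₂ μ₀ * θ₁ μ ≠ 0)
    (B : Matrix (Fin n) (Fin n) ℝ) (hB : B = (A μ₀)⁻¹)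
    (f u : Fin n → ℝ) (hu : u = (A μ)⁻¹ *ᵥ f)
    (m : ℕ) (hm : 1 ≤ m)
    (uhat : Fin n → ℝ)
    -- `uhat` is the Galerkin solution in `K_m = K_m(B A(μ₁), B f)`
    (huhat : uhat ∈ krylov (B * A μ₁) (B *ᵥ f) m)
    (hgal : ∀ v ∈ krylov (B * A μ₁) (B *ᵥ f) m, ((A μ) *ᵥ uhat) ⬝ᵥ v = f ⬝ᵥ v)
    (lammin lammax : ℝ)
    -- `lammin` is the smallest eigenvalue of `B A(μ)`
    (hmin₁ : ∃ v : Fin n → ℝ, v ≠ 0 ∧ (B * A μ) *ᵥ v = lammin • v)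
    (hmin₂ : ∀ (t : ℝ) (v : Fin n → ℝ), v ≠ 0 → (B * A μ) *ᵥ v = t • v → lammin ≤ t)
    -- `lammax` is the largest eigenvalue of `B A(μ)`
    (hmax₁ : ∃ v : Fin n → ℝ, v ≠ 0 ∧ (B * A μ) *ᵥ v = lammax • v)
    (hmax₂ : ∀ (t : ℝ) (v : Fin n → ℝ), v ≠ 0 → (B * A μ) *ᵥ v = t • v → t ≤ lammax)
    (κ : ℝ) (hκ : κ = lammax / lammin) :
    mnorm (A μ) (u - uhat) ≤
      2 * ((Real.sqrt κ - 1) / (Real.sqrt κ + 1)) ^ m * mnorm (A μ) u := by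
  subst hB hu hκ
  have hA₀inv : IsUnit (A μ₀).det := (isUnit_iff_isUnit_det _).mp h0.isUnit
  have hAinv : IsUnit (A μ).det := (isUnit_iff_isUnit_det _).mp hμ.isUnit
  have hsymm₀ : (A μ₀).IsSymm := by
    simpa [IsSymm] using h0.isHermitian.eq
  have hsymm : (A μ).IsSymm := by
    simpa [IsSymm] using hμ.isHermitian.eq
  have hpos : 0 < lammin := by
    obtain ⟨v, hv, hvl⟩ := hmin₁
    have hv' : A μ *ᵥ v = lammin • (A μ₀ *ᵥ v) := by
      rw [← mulVec_smul, ← hvl, mulVec_mulVec,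
        mul_nonsing_inv_cancel_left _ _ hA₀inv]
    have h := hμ.dotProduct_mulVec_pos hv
    rw [hv', dotProduct_smul, smul_eq_mul] at h
    exact pos_of_mul_pos_left h (h0.dotProduct_mulVec_pos hv).le
  have hle : lammin ≤ lammax := by
    obtain ⟨v, hv, hvl⟩ := hmax₁
    exact hmin₂ _ v hv hvl
  have hMu : ((A μ₀)⁻¹ * A μ) *ᵥ ((A μ)⁻¹ *ᵥ f) = (A μ₀)⁻¹ *ᵥ f := by
    rw [mulVec_mulVec, mul_nonsing_inv_cancel_right _ _ hAinv]
  have hAu : A μ *ᵥ ((A μ)⁻¹ *ᵥ f) = f := by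
    rw [mulVec_mulVec, mul_nonsing_inv _ hAinv, one_mulVec]
  set d := θ₁ μ₀ * θ₂ μ₁ - θ₂ μ₀ * θ₁ μ₁ with hd
  have hcomb : A μ = ((θ₁ μ * θ₂ μ₁ - θ₂ μ * θ₁ μ₁) / d) • A μ₀ +
      ((θ₁ μ₀ * θ₂ μ - θ₂ μ₀ * θ₁ μ) / d) • A μ₁ := by
    ext i j
    simp only [hA, Matrix.add_apply, Matrix.smul_apply, smul_eq_mul]
    field_simp
    rw [hd]
    ring
  have hM : (A μ₀)⁻¹ * A μ = ((θ₁ μ * θ₂ μ₁ - θ₂ μ * θ₁ μ₁) / d) • 1 +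
      ((θ₁ μ₀ * θ₂ μ - θ₂ μ₀ * θ₁ μ) / d) • ((A μ₀)⁻¹ * A μ₁) := by
    conv_lhs => rw [hcomb]
    rw [mul_add, Matrix.mul_smul, Matrix.mul_smul, nonsing_inv_mul _ hA₀inv]
  refine galerkin_krylov_error_le hμ ?_ hM hpos hle
    (fun t v hv h => ⟨hmin₂ t v hv h, hmax₂ t v hv h⟩) hm ?_ ?_
  · rw [IsSymm, transpose_mul, transpose_mul, transpose_nonsing_inv,
      hsymm.eq, hsymm₀.eq, mul_assoc]
  · rwa [hMu]
  · rwa [hMu, hAu]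
end

section
/- Let H̃ be a real Hilbert space, let a₁, a₂ : H̃ × H̃ → ℝ be continuous symmetric bilinear forms, let θ₁, θ₂ : P → ℝ be functions on a compact parameter set P, and set a_μ = θ₁(μ)a₁ + θ₂(μ)a₂. Assume there exist constants c₁ ≥ c₂ > 0 such that for all μ ∈ P and all v, w ∈ H̃: a_μ(v, w) ≤ c₁‖v‖_{H̃}‖w‖_{H̃} and a_μ(v, v) ≥ c₂‖v‖_{H̃}². Let f be a continuous linear functional on H̃ and, for each μ ∈ P, let ũ_μ ∈ H̃ be the unique solution of a_μ(ũ_μ, v) = f(v) for all v ∈ H̃. Let M = {ũ_μ : μ ∈ P} be the solution manifold and let d_m(M)_{H̃} = inf over m-dimensional subspaces V_m of H̃ of sup over ũ_μ ∈ M of inf over v ∈ V_m of ‖ũ_μ − v‖_{H̃} be the Kolmogorov m-width. Then for every integer m ≥ 1, d_m(M)_{H̃} ≤ (2/c₂)·((c₁/c₂ − 1)/(c₁/c₂ + 1))^m · ‖f‖_{H̃*}, where ‖f‖_{H̃*} is the operator norm of f. -/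
open Polynomial in
theorem chebyshev_T_sq_add (n : ℕ) :
    Chebyshev.T ℝ n ^ 2 + (1 - X ^ 2) * Chebyshev.U ℝ ((n : ℤ) - 1) ^ 2 = 1 := by
  induction n with
  | zero => simp
  | succ n ih =>
    have h1 := Chebyshev.T_eq_X_mul_T_sub_pol_U ℝ ((n : ℤ) - 1)
    have h2 := Chebyshev.U_eq_X_mul_U_add_T ℝ ((n : ℤ) - 1)
    rw [show (n : ℤ) - 1 + 2 = n + 1 by ring, show (n : ℤ) - 1 + 1 = n by ring] at h1
    rw [show (n : ℤ) - 1 + 1 = n by ring] at h2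
    rw [show ((n + 1 : ℕ) : ℤ) = n + 1 by push_cast; ring, show (n : ℤ) + 1 - 1 = n by ring,
      h1, h2]
    linear_combination ih

open Polynomial in
theorem half_pow_le_chebyshev_T_eval {g y : ℝ} (hg : 1 ≤ g) (hy : (g + g⁻¹) / 2 ≤ y) (m : ℕ) :
    g ^ m / 2 ≤ (Chebyshev.T ℝ m).eval y := by
  have hg0 : 0 < g := by linarith
  have hL : Real.cosh (Real.log g) = (g + g⁻¹) / 2 := Real.cosh_log hg0
  have hy1 : 1 ≤ y := (Real.one_le_cosh (Real.log g)).trans (hL ▸ hy)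
  have hlog : 0 ≤ Real.log g := Real.log_nonneg hg
  have hle : Real.log g ≤ |Real.arcosh y| := by
    have h : Real.cosh (Real.log g) ≤ Real.cosh (Real.arcosh y) := by
      rw [Real.cosh_arcosh hy1, hL]; exact hy
    rwa [Real.cosh_le_cosh, abs_of_nonneg hlog] at h
  have hcm : Real.cosh (m * Real.log g) ≤ Real.cosh (m * Real.arcosh y) := by
    rw [Real.cosh_le_cosh, abs_mul, abs_mul, abs_of_nonneg hlog]
    gcongr
  have hT := Chebyshev.T_real_cosh (Real.arcosh y) m
  rw [Real.cosh_arcosh hy1] at hT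
  rw [hT]
  refine le_trans ?_ hcm
  rw [Real.cosh_eq, Real.exp_nat_mul, Real.exp_log hg0]
  have := Real.exp_pos (-(m * Real.log g))
  linarith

section

variable {H : Type*} [AddCommGroup H] [Module ℝ H] {A : LinearMap.BilinForm ℝ H}
  {B : Module.End ℝ H}

open Polynomial

theorem aeval_apply_comm (hB : ∀ v w, A (B v) w = A v (B w)) (p : ℝ[X]) (v w : H) :
    A (aeval B p v) w = A v (aeval B p w) := by
  induction p using Polynomial.induction_on generalizing v w with
  | C a => simp [Module.algebraMap_end_apply]
  | add p q hp hq => simp [hp, hq]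
  | monomial n a ih =>
    have h : (C a * X ^ (n + 1) : ℝ[X]) = C a * X ^ n * X := by ring
    have h' : (C a * X ^ (n + 1) : ℝ[X]) = X * (C a * X ^ n) := by ring
    calc A (aeval B (C a * X ^ (n + 1)) v) w
        = A (aeval B (C a * X ^ n) (B v)) w := by rw [h, map_mul (aeval B) (C a * X ^ n)]; simp
      _ = A v (B (aeval B (C a * X ^ n) w)) := by rw [ih, hB]
      _ = A v (aeval B (C a * X ^ (n + 1)) w) := by rw [h', map_mul (aeval B) X]; simp

theorem nonneg_aeval_mul_sq (hB : ∀ v w, A (B v) w = A v (B w)) {p : ℝ[X]}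
    (hp : ∀ v, 0 ≤ A (aeval B p v) v) (s : ℝ[X]) (v : H) :
    0 ≤ A (aeval B (p * s ^ 2) v) v := by
  have h : p * s ^ 2 = s * (p * s) := by ring
  have := hp (aeval B s v)
  rw [h, map_mul, Module.End.mul_apply, aeval_apply_comm hB, map_mul, Module.End.mul_apply]
  exact this

theorem nonneg_aeval_mul_sub_mul_sub (hB : ∀ v w, A (B v) w = A v (B w)) {a b : ℝ} (hab : a < b)
    (ha : ∀ v, 0 ≤ A (aeval B (X - C a) v) v) (hb : ∀ v, 0 ≤ A (aeval B (C b - X) v) v) (v : H) :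
    0 ≤ A (aeval B ((X - C a) * (C b - X)) v) v := by
  have h : C (b - a) * ((X - C a) * (C b - X)) =
      (X - C a) * (C b - X) ^ 2 + (C b - X) * (X - C a) ^ 2 := by
    rw [C_sub]; ring
  have h2 := congrArg (fun p => A (aeval B p v) v) h
  have h3 := nonneg_aeval_mul_sq hB ha (C b - X) v
  have h4 := nonneg_aeval_mul_sq hB hb (X - C a) v
  rw [map_mul, map_add] at h2
  simp only [aeval_C, Module.End.mul_apply, Module.algebraMap_end_apply, map_smul,
    LinearMap.smul_apply, LinearMap.add_apply, map_add, smul_eq_mul] at h2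
  exact nonneg_of_mul_nonneg_right (h2 ▸ add_nonneg h3 h4) (sub_pos.2 hab)

theorem nonneg_aeval_affine_mul (hB : ∀ v w, A (B v) w = A v (B w)) {a b : ℝ} (ha0 : 0 ≤ a)
    (hab : a < b) (ha : ∀ v, 0 ≤ A (aeval B (X - C a) v) v)
    (hb : ∀ v, 0 ≤ A (aeval B (C b - X) v) v) {α β : ℝ} (hα : 0 ≤ α) (hβ : 0 ≤ β) (v : H) :
    0 ≤ A (aeval B ((C α + C β * X) * ((X - C a) * (C b - X))) v) v := by
  have h : (C α + C β * X) * ((X - C a) * (C b - X)) =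
      C (α + β * a) * ((X - C a) * (C b - X)) + C β * ((C b - X) * (X - C a) ^ 2) := by
    rw [C_add, C_mul]; ring
  have h3 := nonneg_aeval_mul_sub_mul_sub hB hab ha hb v
  have h4 := nonneg_aeval_mul_sq hB hb (X - C a) v
  rw [h, map_add, map_mul, map_mul (aeval B) (C β)]
  simp only [aeval_C, Module.End.mul_apply, Module.algebraMap_end_apply, map_smul,
    LinearMap.smul_apply, LinearMap.add_apply, map_add, smul_eq_mul]
  positivity

/-- The Chebyshev residual polynomial for the operators `α + β B`. -/
theorem exists_polynomial_residual (hB : ∀ v w, A (B v) w = A v (B w)) {κ : ℝ} (hκ : 1 < κ)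
    (hA : ∀ v, 0 ≤ A v v) (ha : ∀ v, 0 ≤ A (aeval B (X - C κ⁻¹) v) v)
    (hb : ∀ v, 0 ≤ A (aeval B (C κ - X) v) v) {α β : ℝ} (hα : 0 ≤ α) (hβ : 0 < β) {m : ℕ} :
    ∃ p ∈ degreeLT ℝ m, ∀ v,
      0 ≤ A (aeval B ((C α + C β * X) * (C ((2 * ((κ - 1) / (κ + 1)) ^ m) ^ 2) -
        (1 - (C α + C β * X) * p) ^ 2)) v) v := by
  have hκ0 : 0 < κ := by linarith
  have hκ1 : 0 < κ - 1 := by linarith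
  have hab : κ⁻¹ < κ := (inv_lt_one_of_one_lt₀ hκ).trans hκ
  have hd : 0 < κ - κ⁻¹ := by linarith
  set L : ℝ[X] := C (2 / (κ - κ⁻¹)) * X - C ((κ + κ⁻¹) / (κ - κ⁻¹)) with hL
  set T : ℝ[X] := (Chebyshev.T ℝ m).comp L with hTdef
  set x₀ : ℝ := -(α / β) with hx₀
  set t : ℝ := T.eval x₀ with ht
  set g : ℝ := (κ + 1) / (κ - 1) with hg
  have hg1 : 1 ≤ g := by rw [hg, le_div_iff₀ hκ1]; linarith
  have hρ : (κ - 1) / (κ + 1) = g⁻¹ := by rw [hg, inv_div]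
  have htge : g ^ m / 2 ≤ |t| := by
    have hLx : (g + g⁻¹) / 2 ≤ -(L.eval x₀) := by
      have e : -(L.eval x₀) = (g + g⁻¹) / 2 + 2 / (κ - κ⁻¹) * (α / β) := by
        simp only [hL, hx₀, hg, eval_sub, eval_mul, eval_C, eval_X]
        have h2 : (κ + κ⁻¹) / (κ - κ⁻¹) = ((κ + 1) / (κ - 1) + ((κ + 1) / (κ - 1))⁻¹) / 2 := by
          rw [show κ - κ⁻¹ = (κ - 1) * (κ + 1) / κ by field_simp; ring]
          field_simp
          ring
        rw [h2]; ring
      rw [e]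
      have : 0 ≤ 2 / (κ - κ⁻¹) * (α / β) := by positivity
      linarith
    have h := half_pow_le_chebyshev_T_eval hg1 hLx m
    refine h.trans ((le_abs_self _).trans ?_)
    rw [Chebyshev.T_eval_neg, abs_mul, ht, hTdef, eval_comp]
    rcases Int.units_eq_one_or ((m : ℤ).negOnePow) with h | h <;> simp [h]
  have hgm : 0 < g ^ m := by positivity
  have ht0 : t ≠ 0 := abs_pos.1 (by linarith)
  have htsq : (t⁻¹) ^ 2 ≤ (2 * ((κ - 1) / (κ + 1)) ^ m) ^ 2 := by
    rw [hρ, inv_pow g, ← sq_abs t⁻¹, abs_inv]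
    gcongr
    rw [inv_le_comm₀ (abs_pos.2 ht0) (by positivity)]
    rwa [mul_inv, inv_inv, mul_comm, ← div_eq_mul_inv]
  have hroot : IsRoot (1 - C t⁻¹ * T) x₀ := by
    simp [← ht, ht0]
  obtain ⟨p', hp'⟩ := dvd_iff_isRoot.2 hroot
  have hlin : (C α + C β * X) = C β * (X - C x₀) := by
    rw [mul_sub, ← C_mul, hx₀, mul_neg, mul_div_cancel₀ _ hβ.ne', C_neg]; ring
  refine ⟨C β⁻¹ * p', ?_, fun v => ?_⟩
  · rw [mem_degreeLT]
    by_cases hp0 : p' = 0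
    · simp [hp0]
    have hdeg : (1 - C t⁻¹ * T).natDegree ≤ m := by
      have hLd : L.natDegree ≤ 1 := by rw [hL]; compute_degree
      have hTd : T.natDegree ≤ m := by
        rw [hTdef]
        refine natDegree_comp_le.trans ?_
        rw [Chebyshev.natDegree_T]
        simpa using Nat.mul_le_mul_left m hLd
      refine (natDegree_sub_le _ _).trans (max_le (by simp) ((natDegree_C_mul_le _ _).trans hTd))
    rw [hp', natDegree_mul (X_sub_C_ne_zero _) hp0, natDegree_X_sub_C] at hdeg
    rw [degree_C_mul (inv_ne_zero hβ.ne'), degree_eq_natDegree hp0]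
    exact_mod_cast (by omega : p'.natDegree < m)
  · have hq : 1 - (C α + C β * X) * (C β⁻¹ * p') = C t⁻¹ * T := by
      have : C β * C β⁻¹ = (1 : ℝ[X]) := by rw [← C_mul, mul_inv_cancel₀ hβ.ne', C_1]
      rw [hlin]
      linear_combination hp' - (X - C x₀) * p' * this
    have hpell : 1 - T ^ 2 = (C (4 / (κ - κ⁻¹) ^ 2) * ((X - C κ⁻¹) * (C κ - X))) *
        ((Chebyshev.U ℝ ((m : ℤ) - 1)).comp L) ^ 2 := by
      have h := congrArg (fun r : ℝ[X] => r.comp L) (chebyshev_T_sq_add m)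
      simp only [add_comp, mul_comp, sub_comp, pow_comp, one_comp, X_comp] at h
      have h2 : 1 - L ^ 2 = C (4 / (κ - κ⁻¹) ^ 2) * ((X - C κ⁻¹) * (C κ - X)) := by
        apply Polynomial.funext
        intro x
        simp only [hL, eval_sub, eval_mul, eval_C, eval_X, eval_pow, eval_one]
        have hd' := hd.ne'
        generalize κ⁻¹ = a at hd' ⊢
        field_simp
        ring
      rw [← h2]
      linear_combination -h
    have hid : (C α + C β * X) * (C ((2 * ((κ - 1) / (κ + 1)) ^ m) ^ 2) - (C t⁻¹ * T) ^ 2) =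
        C ((t⁻¹) ^ 2 * (4 / (κ - κ⁻¹) ^ 2)) * (((C α + C β * X) * ((X - C κ⁻¹) * (C κ - X))) *
          ((Chebyshev.U ℝ ((m : ℤ) - 1)).comp L) ^ 2) +
        C ((2 * ((κ - 1) / (κ + 1)) ^ m) ^ 2 - (t⁻¹) ^ 2) *
          (C (α + β * κ⁻¹) + C β * (X - C κ⁻¹)) := by
      simp only [C_sub, C_mul, C_add, C_pow] at hpell ⊢
      linear_combination (C α + C β * X) * C t⁻¹ ^ 2 * hpell
    have h1 := nonneg_aeval_mul_sq hB
      (nonneg_aeval_affine_mul hB (by positivity) hab ha hb hα hβ.le)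
      ((Chebyshev.U ℝ ((m : ℤ) - 1)).comp L) v
    have h2 := hA v
    have h3 := ha v
    have h4 : 0 ≤ (2 * ((κ - 1) / (κ + 1)) ^ m) ^ 2 - (t⁻¹) ^ 2 := sub_nonneg.2 htsq
    rw [hq, hid, map_add, map_mul (aeval B) (C (_ * _)), map_mul (aeval B) (C (_ - _)),
      map_add (aeval B) (C _), map_mul (aeval B) (C β)]
    simp only [aeval_C, Module.End.mul_apply, Module.algebraMap_end_apply, map_smul,
      LinearMap.smul_apply, LinearMap.add_apply, map_add, smul_eq_mul]
    positivity

end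

section

variable {H : Type*} [NormedAddCommGroup H] [InnerProductSpace ℝ H] [CompleteSpace H]

open Polynomial in
theorem exists_krylov_space_approx {A₀ A₁ : H →L[ℝ] H →L[ℝ] ℝ}
    (hs₀ : ∀ v w, A₀ v w = A₀ w v) (hs₁ : ∀ v w, A₁ v w = A₁ w v) {c κ : ℝ} (hc : 0 < c)
    (hκ : 1 < κ) (hcoer : ∀ v, c * ‖v‖ ^ 2 ≤ A₀ v v) (h₀₁ : ∀ v, A₀ v v ≤ κ * A₁ v v)
    (h₁₀ : ∀ v, A₁ v v ≤ κ * A₀ v v) (f : H →L[ℝ] ℝ) {m : ℕ} (hm : 1 ≤ m) :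
    ∃ V : Submodule ℝ H, FiniteDimensional ℝ V ∧ Module.finrank ℝ V ≤ m ∧
      ∀ α β : ℝ, 0 ≤ α → 0 ≤ β → ∀ u, (∀ v, α * A₀ u v + β * A₁ u v = f v) →
        ∃ v ∈ V, α * A₀ (u - v) (u - v) + β * A₁ (u - v) (u - v) ≤
          (2 * ((κ - 1) / (κ + 1)) ^ m) ^ 2 * (α * A₀ u u + β * A₁ u u) := by
  have hκ0 : 0 < κ := by linarith
  have hpos : ∀ v, 0 ≤ A₀ v v := fun v => le_trans (by positivity) (hcoer v)
  have hdef : ∀ v w, (∀ z, A₀ v z = A₀ w z) → v = w := by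
    intro v w h
    have h1 := hcoer (v - w)
    have h3 : A₀ (v - w) (v - w) = A₀ v (v - w) - A₀ w (v - w) := by rw [map_sub A₀]; rfl
    rw [h3, h, sub_self] at h1
    have h2 : ‖v - w‖ ^ 2 = 0 := le_antisymm (by nlinarith) (sq_nonneg _)
    exact sub_eq_zero.1 (norm_eq_zero.1 (pow_eq_zero_iff two_ne_zero |>.1 h2))
  have hLM : IsCoercive A₀ := ⟨c, hc, fun v => by simpa [sq, mul_assoc] using hcoer v⟩
  let e := hLM.continuousLinearEquivOfBilin
  have he : ∀ v w, A₀ (e.symm v) w = inner ℝ v w := fun v w => by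
    rw [← hLM.continuousLinearEquivOfBilin_apply]
    exact congrArg (fun x => inner ℝ x w) (e.apply_symm_apply v)
  let B : Module.End ℝ H :=
    e.symm.toLinearMap ∘ₗ (InnerProductSpace.continuousLinearMapOfBilin A₁).toLinearMap
  have hB : ∀ v w, A₀ (B v) w = A₁ v w := fun v w => by
    refine (he _ w).trans ?_
    exact InnerProductSpace.continuousLinearMapOfBilin_apply A₁ v w
  let w₀ : H := e.symm ((InnerProductSpace.toDual ℝ H).symm f)
  have hw₀ : ∀ w, A₀ w₀ w = f w := fun w => by
    rw [he, InnerProductSpace.toDual_symm_apply]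
  let A : LinearMap.BilinForm ℝ H := A₀.toLinearMap₁₂
  have hA : ∀ v w, A v w = A₀ v w := fun _ _ => rfl
  have hAB : ∀ v w, A (B v) w = A v (B w) := fun v w => by
    rw [hA, hA, hB, hs₀, hB, hs₁]
  have ha : ∀ v, 0 ≤ A (aeval B (X - C κ⁻¹) v) v := fun v => by
    have : κ⁻¹ * A₀ v v ≤ A₁ v v := by
      rw [inv_mul_le_iff₀ hκ0]; exact h₀₁ v
    simpa [hA, hB, Module.algebraMap_end_apply] using this
  have hb : ∀ v, 0 ≤ A (aeval B (C κ - X) v) v := fun v => by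
    simpa [hA, hB, Module.algebraMap_end_apply] using h₁₀ v
  let φ : ℝ[X] →ₗ[ℝ] H := (LinearMap.applyₗ w₀) ∘ₗ (aeval B).toLinearMap
  have hφ : ∀ p, φ p = aeval B p w₀ := fun _ => rfl
  have hfin : FiniteDimensional ℝ (degreeLT ℝ m) :=
    (degreeLTEquiv ℝ m).symm.finiteDimensional
  refine ⟨(degreeLT ℝ m).map φ, inferInstance, (Submodule.finrank_map_le _ _).trans ?_, ?_⟩
  · rw [(degreeLTEquiv ℝ m).finrank_eq]; simp
  intro α β hα hβ u hu
  have huw : aeval B (C α + C β * X) u = w₀ := hdef _ _ fun z => by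
    rw [hw₀, ← hu]
    simp [hB, Module.algebraMap_end_apply]
  have hform : ∀ v, α * A₀ v v + β * A₁ v v = A (aeval B (C α + C β * X) v) v := fun v => by
    simp [hA, hB, Module.algebraMap_end_apply]
  obtain ⟨p, hp, hpq⟩ : ∃ p ∈ degreeLT ℝ m, ∀ v,
      0 ≤ A (aeval B ((C α + C β * X) * (C ((2 * ((κ - 1) / (κ + 1)) ^ m) ^ 2) -
        (1 - (C α + C β * X) * p) ^ 2)) v) v := by
    rcases hβ.eq_or_lt with rfl | hβ
    · refine ⟨C α⁻¹, mem_degreeLT.2 (degree_C_le.trans_lt (by exact_mod_cast hm)), fun v => ?_⟩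
      rcases hα.eq_or_lt with rfl | hα
      · simp
      have h : (C α + C 0 * X) * (C ((2 * ((κ - 1) / (κ + 1)) ^ m) ^ 2) -
          (1 - (C α + C 0 * X) * C α⁻¹) ^ 2) = C (α * (2 * ((κ - 1) / (κ + 1)) ^ m) ^ 2) := by
        rw [C_0, zero_mul, add_zero, ← C_mul, mul_inv_cancel₀ hα.ne', C_mul]; simp
      rw [h, aeval_C, Module.algebraMap_end_apply, map_smul, LinearMap.smul_apply, smul_eq_mul]
      exact mul_nonneg (by positivity) (hpos v)
    · exact exists_polynomial_residual hAB hκ hpos ha hb hα hβ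
  refine ⟨aeval B p w₀, Submodule.mem_map.2 ⟨p, hp, rfl⟩, ?_⟩
  have hres : u - aeval B p w₀ = aeval B (1 - (C α + C β * X) * p) u := by
    rw [← huw, ← Module.End.mul_apply, ← map_mul, mul_comm p, map_sub, map_one]
    rfl
  have hsq : A (aeval B (C α + C β * X) (u - aeval B p w₀)) (u - aeval B p w₀) =
      A (aeval B ((C α + C β * X) * (1 - (C α + C β * X) * p) ^ 2) u) u := by
    rw [hres, ← aeval_apply_comm hAB, ← Module.End.mul_apply, ← Module.End.mul_apply, ← map_mul,
      ← map_mul]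
    congr 3
    ring_nf
  have h := hpq u
  rw [mul_sub, map_sub, mul_comm (C α + C β * X) (C _), map_mul (aeval B) (C _) (C α + C β * X),
    LinearMap.sub_apply, map_sub, LinearMap.sub_apply, aeval_C, Module.End.mul_apply,
    Module.algebraMap_end_apply, map_smul, LinearMap.smul_apply, smul_eq_mul, ← hsq,
    ← hform, ← hform] at h
  linarith

end

theorem IsCompact.exists_cone_generators {K : Set (ℝ × ℝ)} (hK : IsCompact K) (hne : K.Nonempty)
    {a b : ℝ} (hab : ∀ θ ∈ K, 0 < a * θ.1 + b * θ.2) :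
    ∃ p ∈ K, ∃ q ∈ K, ∀ θ ∈ K, ∃ α β : ℝ, 0 ≤ α ∧ 0 ≤ β ∧
      θ.1 = α * p.1 + β * q.1 ∧ θ.2 = α * p.2 + β * q.2 := by
  let s : ℝ × ℝ → ℝ := fun θ => (a * θ.2 - b * θ.1) / (a * θ.1 + b * θ.2)
  have hs : ContinuousOn s K :=
    ContinuousOn.div (by fun_prop) (by fun_prop) fun θ hθ => (hab θ hθ).ne'
  obtain ⟨p, hp, hmin⟩ := hK.exists_isMinOn hne hs
  obtain ⟨q, hq, hmax⟩ := hK.exists_isMaxOn hne hs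
  refine ⟨p, hp, q, hq, fun θ hθ => ?_⟩
  have hlp := hab p hp
  have hlq := hab q hq
  have hl := hab θ hθ
  have hnz : a ^ 2 + b ^ 2 ≠ 0 := by
    intro h
    have ha : a = 0 := by nlinarith [sq_nonneg a, sq_nonneg b]
    have hb : b = 0 := by nlinarith [sq_nonneg a, sq_nonneg b]
    simp [ha, hb] at hl
  have hmem : s θ ∈ segment ℝ (s p) (s q) := by
    rw [segment_eq_Icc ((hmin hθ).trans (hmax hθ))]
    exact ⟨hmin hθ, hmax hθ⟩
  obtain ⟨x, y, hx, hy, hxy, hsθ⟩ := hmem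
  refine ⟨(a * θ.1 + b * θ.2) * x / (a * p.1 + b * p.2),
    (a * θ.1 + b * θ.2) * y / (a * q.1 + b * q.2), by positivity, by positivity, ?_⟩
  set α := (a * θ.1 + b * θ.2) * x / (a * p.1 + b * p.2) with hα
  set β := (a * θ.1 + b * θ.2) * y / (a * q.1 + b * q.2) with hβ
  have hαp : α * (a * p.1 + b * p.2) = (a * θ.1 + b * θ.2) * x := div_mul_cancel₀ _ hlp.ne'
  have hβq : β * (a * q.1 + b * q.2) = (a * θ.1 + b * θ.2) * y := div_mul_cancel₀ _ hlq.ne'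
  have hsp : s p * (a * p.1 + b * p.2) = a * p.2 - b * p.1 := div_mul_cancel₀ _ hlp.ne'
  have hsq : s q * (a * q.1 + b * q.2) = a * q.2 - b * q.1 := div_mul_cancel₀ _ hlq.ne'
  have hst : s θ * (a * θ.1 + b * θ.2) = a * θ.2 - b * θ.1 := div_mul_cancel₀ _ hl.ne'
  simp only [smul_eq_mul] at hsθ
  have h1 : a * θ.1 + b * θ.2 = α * (a * p.1 + b * p.2) + β * (a * q.1 + b * q.2) := by
    rw [hαp, hβq, ← mul_add, hxy, mul_one]
  have h2 : a * θ.2 - b * θ.1 = α * (a * p.2 - b * p.1) + β * (a * q.2 - b * q.1) := by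
    rw [← hst, ← hsp, ← hsq, ← hsθ]
    linear_combination -s p * hαp - s q * hβq
  constructor
  · apply mul_left_cancel₀ hnz
    linear_combination a * h1 - b * h2
  · apply mul_left_cancel₀ hnz
    linear_combination b * h1 + a * h2

section

variable {H : Type*} [NormedAddCommGroup H] [InnerProductSpace ℝ H]

theorem isCompact_setOf_bounded_coercive (φ : ℝ × ℝ →ₗ[ℝ] (H →L[ℝ] H →L[ℝ] ℝ))
    (hφ : Function.Injective φ) {c₁ : ℝ} (hc₁ : 0 ≤ c₁) (c₂ : ℝ) :
    IsCompact {θ | (∀ v w, φ θ v w ≤ c₁ * ‖v‖ * ‖w‖) ∧ ∀ v, c₂ * ‖v‖ ^ 2 ≤ φ θ v v} := by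
  have hcont : Continuous φ :=
    LinearMap.continuous_of_finiteDimensional (E := ℝ × ℝ) (F' := H →L[ℝ] H →L[ℝ] ℝ) φ
  have hev : ∀ v w, Continuous fun θ => φ θ v w := fun v w => by fun_prop
  refine Metric.isCompact_of_isClosed_isBounded ?_ ?_
  · simp only [Set.ofPred_and, Set.ofPred_forall]
    exact (isClosed_iInter fun v => isClosed_iInter fun w =>
      isClosed_le (hev v w) continuous_const).inter
        (isClosed_iInter fun v => isClosed_le continuous_const (hev v v))
  · have hanti : Function.Injective φ ↔ ∃ L > 0, AntilipschitzWith L φ :=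
      LinearMap.injective_iff_antilipschitz (𝕜 := ℝ) (E := ℝ × ℝ) (F := H →L[ℝ] H →L[ℝ] ℝ) φ
    obtain ⟨L, -, hL⟩ := hanti.1 hφ
    refine (Metric.isBounded_closedBall (x := (0 : ℝ × ℝ)) (r := L * c₁)).subset fun θ hθ => ?_
    have hn : ‖φ θ‖ ≤ c₁ := by
      refine (φ θ).opNorm_le_bound₂ hc₁ fun v w => ?_
      have h1 := hθ.1 v w
      have h2 := hθ.1 v (-w)
      rw [map_neg, norm_neg] at h2
      exact abs_le.2 ⟨by linarith, h1⟩
    have hd := hL.le_mul_dist θ 0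
    rw [map_zero, dist_zero_right (φ θ)] at hd
    exact hd.trans (by gcongr)

theorem eq_of_apply_self_eq {a b : H →L[ℝ] H →L[ℝ] ℝ} (ha : ∀ v w, a v w = a w v)
    (hb : ∀ v w, b v w = b w v) (h : ∀ v, a v v = b v v) (v w : H) : a v w = b v w := by
  have h1 := h (v + w)
  simp only [map_add, add_apply] at h1
  rw [ha w v, hb w v] at h1
  linarith [h v, h w]

theorem mem_span_singleton_of_proportional {a a' : H →L[ℝ] H →L[ℝ] ℝ} {c : ℝ} (hc : 0 < c)
    (ha : ∀ v, c * ‖v‖ ^ 2 ≤ a v v) (ha' : ∀ v, c * ‖v‖ ^ 2 ≤ a' v v) {k : ℝ}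
    (hk : ∀ v w, a' v w = k * a v w) {u u' : H} (hu : ∀ v, a u v = a' u' v) :
    u' ∈ Submodule.span ℝ {u} := by
  have hzero : ∀ b : H →L[ℝ] H →L[ℝ] ℝ, (∀ v, c * ‖v‖ ^ 2 ≤ b v v) → ∀ v, b v v = 0 → v = 0 := by
    intro b hb v h
    have h1 := hb v
    rw [h] at h1
    exact norm_eq_zero.1 (pow_eq_zero_iff two_ne_zero |>.1
      (le_antisymm (by nlinarith) (sq_nonneg ‖v‖)))
  by_cases hk0 : k = 0
  · have : u' = 0 := hzero a' ha' u' (by rw [hk, hk0, zero_mul])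
    simp [this]
  · have h : u - k • u' = 0 := hzero a ha _ (by
      rw [map_sub a, map_smul a, sub_apply, smul_apply, hu, hk, smul_eq_mul, sub_self])
    refine Submodule.mem_span_singleton.2 ⟨k⁻¹, ?_⟩
    rw [sub_eq_zero.1 h, inv_smul_smul₀ hk0]

theorem norm_sub_le_of_energy_le {a : H →L[ℝ] H →L[ℝ] ℝ} {c τ : ℝ} (hc : 0 < c) (hτ : 0 ≤ τ)
    (ha : ∀ v, c * ‖v‖ ^ 2 ≤ a v v) {f : H →L[ℝ] ℝ} {u v : H} (hu : a u u = f u)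
    (h : a (u - v) (u - v) ≤ τ ^ 2 * a u u) : ‖u - v‖ ≤ τ / c * ‖f‖ := by
  have hfu : f u ≤ ‖f‖ * ‖u‖ := (le_abs_self _).trans (f.le_opNorm u)
  have hnu : c * ‖u‖ ≤ ‖f‖ := by
    rcases (norm_nonneg u).eq_or_lt with h0 | h0
    · rw [← h0, mul_zero]; exact norm_nonneg f
    · exact le_of_mul_le_mul_right (by nlinarith [ha u]) h0
  have hE : c * a u u ≤ ‖f‖ ^ 2 := by
    rw [hu]; nlinarith [norm_nonneg f, norm_nonneg u]
  have hsq : (c * ‖u - v‖) ^ 2 ≤ (τ * ‖f‖) ^ 2 := by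
    nlinarith [mul_le_mul_of_nonneg_left (ha (u - v)) hc.le, mul_le_mul_of_nonneg_left h hc.le,
      mul_le_mul_of_nonneg_left hE (sq_nonneg τ)]
  have := (sq_le_sq₀ (by positivity) (by positivity)).1 hsq
  rw [div_mul_eq_mul_div, le_div_iff₀ hc]
  linarith

end

theorem stmt6 {H : Type*} [NormedAddCommGroup H] [InnerProductSpace ℝ H] [CompleteSpace H]
    {P : Type*} [TopologicalSpace P] [CompactSpace P]
    (a₁ a₂ : H →L[ℝ] H →L[ℝ] ℝ)
    (hsym₁ : ∀ v w : H, a₁ v w = a₁ w v) (hsym₂ : ∀ v w : H, a₂ v w = a₂ w v)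
    (θ₁ θ₂ : P → ℝ) (c₁ c₂ : ℝ) (hc : c₂ ≤ c₁) (hc₂ : 0 < c₂)
    -- boundedness of `a_μ = θ₁(μ) a₁ + θ₂(μ) a₂`
    (hbdd : ∀ (μ : P) (v w : H), θ₁ μ * a₁ v w + θ₂ μ * a₂ v w ≤ c₁ * ‖v‖ * ‖w‖)
    -- coercivity of `a_μ`
    (hcoer : ∀ (μ : P) (v : H), c₂ * ‖v‖ ^ 2 ≤ θ₁ μ * a₁ v v + θ₂ μ * a₂ v v)
    (f : H →L[ℝ] ℝ) (u : P → H)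
    -- `u μ` solves `a_μ(u μ, v) = f(v)` for all `v`
    (hu : ∀ (μ : P) (v : H), θ₁ μ * a₁ (u μ) v + θ₂ μ * a₂ (u μ) v = f v)
    (m : ℕ) (hm : 1 ≤ m) :
    -- the Kolmogorov m-width of the solution manifold `{u μ : μ ∈ P}` is at most the bound
    ∃ V : Submodule ℝ H, FiniteDimensional ℝ V ∧ Module.finrank ℝ V ≤ m ∧
      ∀ μ : P, ∃ v ∈ V, ‖u μ - v‖ ≤ (2 / c₂) * ((c₁ / c₂ - 1) / (c₁ / c₂ + 1)) ^ m * ‖f‖ := by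
  have hbound : 0 ≤ (2 / c₂) * ((c₁ / c₂ - 1) / (c₁ / c₂ + 1)) ^ m * ‖f‖ := by
    have : 1 ≤ c₁ / c₂ := (one_le_div hc₂).2 hc
    have : 0 ≤ c₁ / c₂ - 1 := by linarith
    positivity
  rcases isEmpty_or_nonempty P with hP | ⟨⟨μ₀⟩⟩
  · exact ⟨⊥, inferInstance, by simp, fun μ => hP.elim μ⟩
  let φ : ℝ × ℝ →ₗ[ℝ] (H →L[ℝ] H →L[ℝ] ℝ) :=
    (LinearMap.toSpanSingleton ℝ _ a₁).coprod (LinearMap.toSpanSingleton ℝ _ a₂)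
  have hφ : ∀ θ v w, φ θ v w = θ.1 * a₁ v w + θ.2 * a₂ v w := fun θ v w => by simp [φ]
  have hprop : (∀ μ, ∃ k, ∀ v w, φ (θ₁ μ, θ₂ μ) v w = k * φ (θ₁ μ₀, θ₂ μ₀) v w) →
      ∃ V : Submodule ℝ H, FiniteDimensional ℝ V ∧ Module.finrank ℝ V ≤ m ∧ ∀ μ : P, ∃ v ∈ V,
        ‖u μ - v‖ ≤ (2 / c₂) * ((c₁ / c₂ - 1) / (c₁ / c₂ + 1)) ^ m * ‖f‖ := by
    intro h
    refine ⟨Submodule.span ℝ {u μ₀}, inferInstance,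
      (finrank_span_le_card {u μ₀}).trans (by simpa using hm), fun μ => ⟨u μ, ?_, by simpa using hbound⟩⟩
    obtain ⟨k, hk⟩ := h μ
    refine mem_span_singleton_of_proportional hc₂ (fun v => ?_) (fun v => ?_) hk fun v => ?_
    · rw [hφ]; exact hcoer μ₀ v
    · rw [hφ]; exact hcoer μ v
    · rw [hφ, hφ, hu, hu]
  have hsym : ∀ θ v w, φ θ v w = φ θ w v := fun θ v w => by
    rw [hφ, hφ, hsym₁ v w, hsym₂ v w]
  rcases subsingleton_or_nontrivial H with hH | hH
  · exact hprop fun μ => ⟨0, fun v w => by simp [Subsingleton.elim v 0]⟩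
  rcases hc.eq_or_lt with rfl | hlt
  · refine hprop fun μ => ⟨1, fun v w => ?_⟩
    rw [one_mul]
    refine eq_of_apply_self_eq (hsym _) (hsym _) (fun v => ?_) v w
    rw [hφ, hφ]
    have h1 := hbdd μ v v
    have h2 := hbdd μ₀ v v
    have h3 := hcoer μ v
    have h4 := hcoer μ₀ v
    rw [sq, ← mul_assoc] at h3 h4
    exact (le_antisymm h1 h3).trans (le_antisymm h2 h4).symm
  obtain ⟨v₀, hv₀⟩ := exists_ne (0 : H)
  have hv₀n : 0 < c₂ * ‖v₀‖ ^ 2 := by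
    have := norm_pos_iff.2 hv₀
    positivity
  by_cases hinj : Function.Injective φ
  swap
  · rw [injective_iff_map_eq_zero φ] at hinj
    push Not at hinj
    obtain ⟨n, hn, hn0⟩ := hinj
    have hn' : ∀ v w, n.1 * a₁ v w + n.2 * a₂ v w = 0 := fun v w => by
      rw [← hφ, hn]; rfl
    have hD : θ₁ μ₀ * n.2 - θ₂ μ₀ * n.1 ≠ 0 := by
      intro hD
      have hpos := hv₀n.trans_le (hcoer μ₀ v₀)
      have hz := hn' v₀ v₀
      refine hn0 (Prod.ext ?_ ?_)
      · refine (mul_eq_zero.1 ?_).resolve_right hpos.ne'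
        linear_combination θ₁ μ₀ * hz - a₂ v₀ v₀ * hD
      · refine (mul_eq_zero.1 ?_).resolve_right hpos.ne'
        linear_combination θ₂ μ₀ * hz + a₁ v₀ v₀ * hD
    refine hprop fun μ => ⟨(θ₁ μ * n.2 - θ₂ μ * n.1) / (θ₁ μ₀ * n.2 - θ₂ μ₀ * n.1),
      fun v w => ?_⟩
    rw [hφ, hφ, div_mul_eq_mul_div, eq_div_iff hD]
    linear_combination (θ₁ μ₀ * θ₂ μ - θ₁ μ * θ₂ μ₀) * hn' v w
  have hK := isCompact_setOf_bounded_coercive φ hinj (hc₂.le.trans hc) c₂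
  have hmem : ∀ μ, (θ₁ μ, θ₂ μ) ∈
      {θ | (∀ v w, φ θ v w ≤ c₁ * ‖v‖ * ‖w‖) ∧ ∀ v, c₂ * ‖v‖ ^ 2 ≤ φ θ v v} := fun μ =>
    ⟨fun v w => by rw [hφ]; exact hbdd μ v w, fun v => by rw [hφ]; exact hcoer μ v⟩
  obtain ⟨p, hp, q, hq, hpq⟩ := hK.exists_cone_generators ⟨_, hmem μ₀⟩
    (a := a₁ v₀ v₀) (b := a₂ v₀ v₀) fun θ hθ => by
      have h := hv₀n.trans_le (hθ.2 v₀)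
      rw [hφ] at h
      linarith
  have hratio : ∀ {θ θ' : ℝ × ℝ}, (∀ v w, φ θ v w ≤ c₁ * ‖v‖ * ‖w‖) →
      (∀ v, c₂ * ‖v‖ ^ 2 ≤ φ θ' v v) → ∀ v, φ θ v v ≤ c₁ / c₂ * φ θ' v v := by
    intro θ θ' h h' v
    have h1 := mul_le_mul_of_nonneg_left (h' v) (div_nonneg (hc₂.le.trans hc) hc₂.le)
    have h2 : c₁ / c₂ * (c₂ * ‖v‖ ^ 2) = c₁ * ‖v‖ * ‖v‖ := by field_simp
    exact (h v v).trans (h2 ▸ h1)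
  obtain ⟨V, hVf, hVm, hV⟩ := exists_krylov_space_approx (hsym p) (hsym q) hc₂
    ((one_lt_div hc₂).2 hlt) hp.2 (hratio hp.1 hq.2) (hratio hq.1 hp.2) f hm
  refine ⟨V, hVf, hVm, fun μ => ?_⟩
  obtain ⟨α, β, hα, hβ, h1, h2⟩ := hpq _ (hmem μ)
  have hcomb : ∀ v w, α * φ p v w + β * φ q v w = φ (θ₁ μ, θ₂ μ) v w := fun v w => by
    rw [hφ, hφ, hφ, h1, h2]
    ring
  obtain ⟨v, hv, hle⟩ := hV α β hα hβ (u μ) fun w => by rw [hcomb, hφ, hu]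
  rw [hcomb, hcomb] at hle
  have hτ : 0 ≤ 2 * ((c₁ / c₂ - 1) / (c₁ / c₂ + 1)) ^ m := by
    have : 1 < c₁ / c₂ := (one_lt_div hc₂).2 hlt
    have : 0 ≤ c₁ / c₂ - 1 := by linarith
    positivity
  have hfin := norm_sub_le_of_energy_le hc₂ hτ (hmem μ).2
    ((hφ _ _ _).trans (hu μ (u μ))) hle
  refine ⟨v, hv, hfin.trans_eq ?_⟩
  ring
end
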